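/- (Lemma A.2.) Let π₁ and π₂ be any two policies such that E_{s∼d_{π₁}}[D_TV(π₁(·|s), π₂(·|s))] ≤ α for some α ≥ 0. Then the discounted state visitation distributions satisfy ‖d_{π₁} − d_{π₂}‖₁ ≤ 2α/(1−γ). -/

import Mathlib

open scoped BigOperators

noncomputable section

/-- `p` is a probability distribution on a finite type. -/
def IsDist {X : Type*} [Fintype X] (p : X → ℝ) : Prop :=
  (∀ x, 0 ≤ p x) ∧ ∑ x, p x = 1

/-- `P` is a transition dynamics: `P s a` is a distribution over next states. -/
def IsDynamics {S A : Type*} [Fintype S] (P : S → A → S → ℝ) : Prop :=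
  ∀ s a, IsDist (P s a)

/-- `π` is a (stochastic) policy: `π s` is a distribution over actions. -/
def IsPolicy {S A : Type*} [Fintype A] (π : S → A → ℝ) : Prop :=
  ∀ s, IsDist (π s)

/-- One-step evolution of a state distribution under policy `π` and dynamics `P`. -/
def step {S A : Type*} [Fintype S] [Fintype A]
    (P : S → A → S → ℝ) (π : S → A → ℝ) (d : S → ℝ) : S → ℝ :=
  fun s' => ∑ s, ∑ a, d s * π s a * P s a s'

/-- The time-`t` state distribution `d_π^t` starting from `ρ₀`. -/
def stateDist {S A : Type*} [Fintype S] [Fintype A]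
    (P : S → A → S → ℝ) (π : S → A → ℝ) (ρ₀ : S → ℝ) : ℕ → S → ℝ
  | 0 => ρ₀
  | t + 1 => step P π (stateDist P π ρ₀ t)

/-- Discounted state visitation distribution `d_π = (1-γ) Σ_t γ^t d_π^t`. -/
def visit {S A : Type*} [Fintype S] [Fintype A]
    (γ : ℝ) (P : S → A → S → ℝ) (π : S → A → ℝ) (ρ₀ : S → ℝ) : S → ℝ :=
  fun s => (1 - γ) * ∑' t : ℕ, γ ^ t * stateDist P π ρ₀ t s

/-- Expected cost of one step when the state is distributed as `d` and actions follow `π`. -/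
def expCost {S A : Type*} [Fintype S] [Fintype A]
    (c : S → A → ℝ) (π : S → A → ℝ) (d : S → ℝ) : ℝ :=
  ∑ s, ∑ a, d s * π s a * c s a

/-- Value function `V^π(s₀)`: expected total discounted cost starting at `s₀`. -/
def Vf {S A : Type*} [Fintype S] [Fintype A] [DecidableEq S]
    (γ : ℝ) (P : S → A → S → ℝ) (c : S → A → ℝ) (π : S → A → ℝ) (s₀ : S) : ℝ :=
  ∑' t : ℕ, γ ^ t * expCost c π (stateDist P π (fun s => if s = s₀ then 1 else 0) t)

/-- Objective `J(π) = E_{s∼ρ₀}[V^π(s)]`. -/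
def Jf {S A : Type*} [Fintype S] [Fintype A] [DecidableEq S]
    (γ : ℝ) (P : S → A → S → ℝ) (c : S → A → ℝ) (ρ₀ : S → ℝ) (π : S → A → ℝ) : ℝ :=
  ∑ s, ρ₀ s * Vf γ P c π s

/-- State-action value `Q^π(s,a) = c(s,a) + γ E_{s'∼P_{s,a}}[V^π(s')]`. -/
def Qf {S A : Type*} [Fintype S] [Fintype A] [DecidableEq S]
    (γ : ℝ) (P : S → A → S → ℝ) (c : S → A → ℝ) (π : S → A → ℝ) (s : S) (a : A) : ℝ :=
  c s a + γ * ∑ s', P s a s' * Vf γ P c π s'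

/-- Disadvantage function `A^π(s,a) = Q^π(s,a) - V^π(s)`. -/
def Adv {S A : Type*} [Fintype S] [Fintype A] [DecidableEq S]
    (γ : ℝ) (P : S → A → S → ℝ) (c : S → A → ℝ) (π : S → A → ℝ) (s : S) (a : A) : ℝ :=
  Qf γ P c π s a - Vf γ P c π s

lemma step_sub {S A : Type*} [Fintype S] [Fintype A]
    (P : S → A → S → ℝ) (π : S → A → ℝ) (d e : S → ℝ) :
    step P π (d - e) = step P π d - step P π e := by
  ext s'
  simp only [step, Pi.sub_apply, sub_mul, Finset.sum_sub_distrib]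

lemma isDist_step {S A : Type*} [Fintype S] [Fintype A]
    {P : S → A → S → ℝ} {π : S → A → ℝ} {d : S → ℝ}
    (hd : IsDist d) (hP : IsDynamics P) (hπ : IsPolicy π) : IsDist (step P π d) := by
  refine ⟨fun s' => Finset.sum_nonneg fun s _ => Finset.sum_nonneg fun a _ =>
    mul_nonneg (mul_nonneg (hd.1 s) ((hπ s).1 a)) ((hP s a).1 s'), ?_⟩
  unfold step
  rw [Finset.sum_comm]
  simp_rw [Finset.sum_comm (s := (Finset.univ : Finset S)) (t := (Finset.univ : Finset A)),
    ← Finset.mul_sum, (hP _ _).2, mul_one]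
  rw [Finset.sum_comm]
  simp_rw [← Finset.mul_sum, (hπ _).2, mul_one, hd.2]

lemma IsDist.le_one {X : Type*} [Fintype X] {p : X → ℝ} (hp : IsDist p) (x : X) : p x ≤ 1 :=
  hp.2 ▸ Finset.single_le_sum (fun y _ => hp.1 y) (Finset.mem_univ x)

lemma isDist_stateDist {S A : Type*} [Fintype S] [Fintype A]
    {P : S → A → S → ℝ} {π : S → A → ℝ} {ρ₀ : S → ℝ}
    (hP : IsDynamics P) (hπ : IsPolicy π) (hρ : IsDist ρ₀) :
    ∀ t, IsDist (stateDist P π ρ₀ t)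
  | 0 => hρ
  | t + 1 => isDist_step (isDist_stateDist hP hπ hρ t) hP hπ

lemma summable_discounted_stateDist {S A : Type*} [Fintype S] [Fintype A]
    {γ : ℝ} {P : S → A → S → ℝ} {π : S → A → ℝ} {ρ₀ : S → ℝ}
    (hγ : 0 ≤ γ) (hγ' : γ < 1) (hP : IsDynamics P) (hπ : IsPolicy π) (hρ : IsDist ρ₀) (s : S) :
    Summable fun t : ℕ => γ ^ t * stateDist P π ρ₀ t s :=
  (summable_geometric_of_lt_one hγ hγ').of_nonneg_of_le
    (fun t => mul_nonneg (pow_nonneg hγ t) ((isDist_stateDist hP hπ hρ t).1 s))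
    (fun t => mul_le_of_le_one_right (pow_nonneg hγ t) ((isDist_stateDist hP hπ hρ t).le_one s))

lemma visit_nonneg {S A : Type*} [Fintype S] [Fintype A]
    {γ : ℝ} {P : S → A → S → ℝ} {π : S → A → ℝ} {ρ₀ : S → ℝ}
    (hγ : 0 ≤ γ) (hγ' : γ < 1) (hP : IsDynamics P) (hπ : IsPolicy π) (hρ : IsDist ρ₀) (s : S) :
    0 ≤ visit γ P π ρ₀ s :=
  mul_nonneg (sub_nonneg.2 hγ'.le) (tsum_nonneg fun t =>
    mul_nonneg (pow_nonneg hγ t) ((isDist_stateDist hP hπ hρ t).1 s))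

/-- The Bellman flow equation for the discounted visitation distribution. -/
lemma visit_eq_add_step {S A : Type*} [Fintype S] [Fintype A]
    {γ : ℝ} {P : S → A → S → ℝ} {π : S → A → ℝ} {ρ₀ : S → ℝ}
    (hγ : 0 ≤ γ) (hγ' : γ < 1) (hP : IsDynamics P) (hπ : IsPolicy π) (hρ : IsDist ρ₀) (s' : S) :
    visit γ P π ρ₀ s' = (1 - γ) * ρ₀ s' + γ * step P π (visit γ P π ρ₀) s' := by
  have hs := summable_discounted_stateDist hγ hγ' hP hπ hρ
  have hstep : HasSum (fun t : ℕ => γ ^ t * stateDist P π ρ₀ (t + 1) s')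
      (∑ s, ∑ a, (∑' t : ℕ, γ ^ t * stateDist P π ρ₀ t s) * (π s a * P s a s')) := by
    refine (hasSum_sum fun s _ => hasSum_sum fun a _ =>
      (hs s).hasSum.mul_right (π s a * P s a s')).congr_fun fun t => ?_
    simp only [stateDist, step, Finset.mul_sum, mul_assoc]
  have htail : ∑' t : ℕ, γ ^ (t + 1) * stateDist P π ρ₀ (t + 1) s' =
      γ * ∑ s, ∑ a, (∑' t : ℕ, γ ^ t * stateDist P π ρ₀ t s) * (π s a * P s a s') := by
    rw [← hstep.tsum_eq, ← tsum_mul_left]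
    exact tsum_congr fun t => by ring
  have hvisit : step P π (visit γ P π ρ₀) s' = (1 - γ) *
      ∑ s, ∑ a, (∑' t : ℕ, γ ^ t * stateDist P π ρ₀ t s) * (π s a * P s a s') := by
    simp only [step, visit, Finset.mul_sum, mul_assoc]
  rw [hvisit, visit, (hs s').tsum_eq_zero_add, htail]
  simp only [pow_zero, one_mul, stateDist]
  ring

/-- A kernel `∑ a, w s a * P s a ·` has `ℓ¹` norm at most that of its weights. -/
lemma sum_abs_sum_mul_dynamics_le {S A : Type*} [Fintype S] [Fintype A]
    {P : S → A → S → ℝ} (hP : IsDynamics P) (w : S → A → ℝ) :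
    ∑ s', |∑ s, ∑ a, w s a * P s a s'| ≤ ∑ s, ∑ a, |w s a| := by
  calc ∑ s', |∑ s, ∑ a, w s a * P s a s'|
      ≤ ∑ s', ∑ s, ∑ a, |w s a| * P s a s' := by
        refine Finset.sum_le_sum fun s' _ => (Finset.abs_sum_le_sum_abs _ _).trans
          (Finset.sum_le_sum fun s _ => (Finset.abs_sum_le_sum_abs _ _).trans
          (Finset.sum_le_sum fun a _ => ?_))
        rw [abs_mul, abs_of_nonneg ((hP s a).1 s')]
    _ = ∑ s, ∑ a, |w s a| := by
        rw [Finset.sum_comm]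
        refine Finset.sum_congr rfl fun s _ => ?_
        rw [Finset.sum_comm]
        simp_rw [← Finset.mul_sum, (hP _ _).2, mul_one]

lemma sum_abs_step_le {S A : Type*} [Fintype S] [Fintype A]
    {P : S → A → S → ℝ} {π : S → A → ℝ} (hP : IsDynamics P) (hπ : IsPolicy π) (d : S → ℝ) :
    ∑ s', |step P π d s'| ≤ ∑ s, |d s| := by
  refine (sum_abs_sum_mul_dynamics_le hP fun s a => d s * π s a).trans_eq
    (Finset.sum_congr rfl fun s _ => ?_)
  simp_rw [abs_mul, abs_of_nonneg ((hπ s).1 _), ← Finset.mul_sum, (hπ s).2, mul_one]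

lemma sum_abs_step_sub_step_le {S A : Type*} [Fintype S] [Fintype A]
    {P : S → A → S → ℝ} (hP : IsDynamics P) (π₁ π₂ : S → A → ℝ) (d : S → ℝ) :
    ∑ s', |step P π₁ d s' - step P π₂ d s'| ≤ ∑ s, |d s| * ∑ a, |π₁ s a - π₂ s a| := by
  have h := sum_abs_sum_mul_dynamics_le hP fun s a => d s * (π₁ s a - π₂ s a)
  simp_rw [abs_mul, ← Finset.mul_sum] at h
  simpa only [step, mul_sub, sub_mul, Finset.sum_sub_distrib] using h

/-- **Lemma A.2.** If `E_{s∼d_{π₁}}[D_TV(π₁(·|s), π₂(·|s))] ≤ α`, then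
`‖d_{π₁} - d_{π₂}‖₁ ≤ 2α/(1-γ)`. -/
theorem visit_l1_diff_le
    {S A : Type*} [Fintype S] [Fintype A]
    (γ : ℝ) (P : S → A → S → ℝ) (ρ₀ : S → ℝ)
    (hγ : 0 < γ) (hγ' : γ < 1) (hP : IsDynamics P) (hρ : IsDist ρ₀)
    (π₁ π₂ : S → A → ℝ) (hπ₁ : IsPolicy π₁) (hπ₂ : IsPolicy π₂)
    (α : ℝ) (hα : 0 ≤ α)
    (htv : ∑ s, visit γ P π₁ ρ₀ s * ((∑ a, |π₁ s a - π₂ s a|) / 2) ≤ α) :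
    ∑ s, |visit γ P π₁ ρ₀ s - visit γ P π₂ ρ₀ s| ≤ 2 * α / (1 - γ) := by
  set d₁ := visit γ P π₁ ρ₀
  set d₂ := visit γ P π₂ ρ₀
  have hpolicy : ∑ s', |step P π₁ d₁ s' - step P π₂ d₁ s'| ≤ 2 * α := by
    refine (sum_abs_step_sub_step_le hP π₁ π₂ d₁).trans ?_
    simp_rw [mul_div_assoc', ← Finset.sum_div] at htv
    have habs (s : S) : |d₁ s| = d₁ s := abs_of_nonneg (visit_nonneg hγ.le hγ' hP hπ₁ hρ s)
    simp_rw [habs]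
    linarith
  have hrec : ∑ s, |d₁ s - d₂ s| ≤ γ * (2 * α + ∑ s, |d₁ s - d₂ s|) := by
    calc ∑ s, |d₁ s - d₂ s|
        = ∑ s, γ * |(step P π₁ d₁ s - step P π₂ d₁ s) + step P π₂ (d₁ - d₂) s| := by
          refine Finset.sum_congr rfl fun s _ => ?_
          have h₁ := visit_eq_add_step hγ.le hγ' hP hπ₁ hρ s
          have h₂ := visit_eq_add_step hγ.le hγ' hP hπ₂ hρ s
          have h : d₁ s - d₂ s =
              γ * ((step P π₁ d₁ s - step P π₂ d₁ s) + step P π₂ (d₁ - d₂) s) := by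
            rw [step_sub, Pi.sub_apply]
            linear_combination h₁ - h₂
          rw [h, abs_mul, abs_of_pos hγ]
      _ ≤ γ * (∑ s, |step P π₁ d₁ s - step P π₂ d₁ s| + ∑ s, |step P π₂ (d₁ - d₂) s|) := by
          rw [← Finset.mul_sum, ← Finset.sum_add_distrib]
          gcongr
          exact abs_add_le _ _
      _ ≤ γ * (2 * α + ∑ s, |d₁ s - d₂ s|) := by
          exact mul_le_mul_of_nonneg_left
            (add_le_add hpolicy (sum_abs_step_le hP hπ₂ (d₁ - d₂))) hγ.le
  rw [le_div_iff₀ (sub_pos.2 hγ')]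
  nlinarith
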